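/- Let A be an associative superalgebra over a commutative unital ring K, regarded as a Lie superalgebra with [a,b] = ab − (−1)^{|a||b|}ba, with the crossed A-modules (HC₁(A),0), (V(A),μ) and ([A,A],i) as above. Then: (i) H̄₀(A, HC₁(A)) = HC₁(A); (ii) H̄₁(A, HC₁(A)) ≅ (A/[A,A]) ⊗_K HC₁(A); (iii) H̄₀(A, [A,A]) = [A,A]/[A,[A,A]]; (iv) H̄₀(A, V(A)) ≅ HC₁^M(A). -/

import Mathlib

open scoped TensorProduct

namespace SuperNA

/-- The sign `(-1)^(|α||β|)` appearing in super-algebra identities. -/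
def ssign (α β : ZMod 2) : ℤ := (-1 : ℤ) ^ (α.val * β.val)

/-- A Lie superalgebra over a commutative unital ring `K`: a `ℤ/2`-graded `K`-module
with a bilinear bracket satisfying the graded skew-symmetry, the graded Jacobi
(Leibniz form) identity, and `[x₀,x₀] = 0` for even `x₀`. -/
structure LieSuperalgebra (K : Type) [CommRing K] : Type 1 where
  carrier : Type
  [isAddCommGroup : AddCommGroup carrier]
  [isModule : Module K carrier]
  grading : ZMod 2 → Submodule K carrier
  isInternal : DirectSum.IsInternal grading
  bracket : carrier →ₗ[K] carrier →ₗ[K] carrier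
  bracket_grading : ∀ (α β : ZMod 2) (x y : carrier),
    x ∈ grading α → y ∈ grading β → bracket x y ∈ grading (α + β)
  super_skew : ∀ (α β : ZMod 2) (x y : carrier), x ∈ grading α → y ∈ grading β →
    bracket x y = -(ssign α β • bracket y x)
  super_jacobi : ∀ (α β : ZMod 2) (x y : carrier), x ∈ grading α → y ∈ grading β →
    ∀ z : carrier, bracket x (bracket y z)
      = bracket (bracket x y) z + ssign α β • bracket y (bracket x z)
  bracket_self_even : ∀ x ∈ grading 0, bracket x x = 0

attribute [instance] LieSuperalgebra.isAddCommGroup LieSuperalgebra.isModule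

variable {K : Type} [CommRing K]

instance : CoeSort (LieSuperalgebra K) Type := ⟨LieSuperalgebra.carrier⟩

/-- A homomorphism of Lie superalgebras: an even linear map preserving brackets. -/
structure LieSuperHom (L M : LieSuperalgebra K) where
  toLinear : L.carrier →ₗ[K] M.carrier
  map_grading : ∀ (α : ZMod 2), ∀ x ∈ L.grading α, toLinear x ∈ M.grading α
  map_bracket : ∀ x y, toLinear (L.bracket x y) = M.bracket (toLinear x) (toLinear y)

/-- An action of the Lie superalgebra `P` on the Lie superalgebra `M`. -/
structure LieSuperAction (P M : LieSuperalgebra K) where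
  act : P.carrier →ₗ[K] M.carrier →ₗ[K] M.carrier
  act_grading : ∀ (α β : ZMod 2) (p : P.carrier) (m : M.carrier),
    p ∈ P.grading α → m ∈ M.grading β → act p m ∈ M.grading (α + β)
  act_bracket : ∀ (α β : ZMod 2) (p p' : P.carrier), p ∈ P.grading α → p' ∈ P.grading β →
    ∀ m : M.carrier, act (P.bracket p p') m = act p (act p' m) - ssign α β • act p' (act p m)
  act_super_der : ∀ (α β : ZMod 2) (p : P.carrier) (m : M.carrier),
    p ∈ P.grading α → m ∈ M.grading β → ∀ m' : M.carrier,
    act p (M.bracket m m') = M.bracket (act p m) m' + ssign α β • M.bracket m (act p m')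

/-- Two mutual actions are compatible. -/
structure AreCompatible {M N : LieSuperalgebra K}
    (aMN : LieSuperAction M N) (aNM : LieSuperAction N M) : Prop where
  compat_left : ∀ (α β : ZMod 2) (m : M.carrier) (n : N.carrier),
    m ∈ M.grading α → n ∈ N.grading β → ∀ n' : N.carrier,
    aMN.act (aNM.act n m) n' = -(ssign α β • N.bracket (aMN.act m n) n')
  compat_right : ∀ (α β : ZMod 2) (m : M.carrier) (n : N.carrier),
    m ∈ M.grading α → n ∈ N.grading β → ∀ m' : M.carrier,
    aNM.act (aMN.act m n) m' = -(ssign α β • M.bracket (aNM.act n m) m')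

/-- A crossed module of Lie superalgebras `∂ : M → P`. -/
structure CrossedModule (M P : LieSuperalgebra K) where
  act : LieSuperAction P M
  d : LieSuperHom M P
  cm_act : ∀ (p : P.carrier) (m : M.carrier), d.toLinear (act.act p m) = P.bracket p (d.toLinear m)
  cm_peiffer : ∀ (m m' : M.carrier), act.act (d.toLinear m) m' = M.bracket m m'

/-- A morphism of crossed `P`-modules. -/
structure CMHom {P M N : LieSuperalgebra K} (cmM : CrossedModule M P) (cmN : CrossedModule N P) where
  hom : LieSuperHom M N
  equivariant : ∀ (p : P.carrier) (m : M.carrier),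
    hom.toLinear (cmM.act.act p m) = cmN.act.act p (hom.toLinear m)
  comm : ∀ m : M.carrier, cmN.d.toLinear (hom.toLinear m) = cmM.d.toLinear m

/-- The data of a family of "tensor symbols" in a Lie superalgebra `Q`, indexed by pairs of
homogeneous elements of `M` and `N`, satisfying the defining relations of the non-abelian
tensor product `M ⊗ N`. -/
structure TensorData {M N : LieSuperalgebra K}
    (aMN : LieSuperAction M N) (aNM : LieSuperAction N M) (Q : LieSuperalgebra K) where
  pair : (α β : ZMod 2) → M.grading α → N.grading β → Q.carrier
  pair_grading : ∀ (α β : ZMod 2) (m : M.grading α) (n : N.grading β),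
    pair α β m n ∈ Q.grading (α + β)
  pair_smul_left : ∀ (α β : ZMod 2) (c : K) (m : M.grading α) (n : N.grading β),
    pair α β (c • m) n = c • pair α β m n
  pair_smul_right : ∀ (α β : ZMod 2) (c : K) (m : M.grading α) (n : N.grading β),
    pair α β m (c • n) = c • pair α β m n
  pair_add_left : ∀ (α β : ZMod 2) (m m' : M.grading α) (n : N.grading β),
    pair α β (m + m') n = pair α β m n + pair α β m' n
  pair_add_right : ∀ (α β : ZMod 2) (m : M.grading α) (n n' : N.grading β),
    pair α β m (n + n') = pair α β m n + pair α β m n'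
  pair_bracket_left : ∀ (α α' β : ZMod 2) (m : M.grading α) (m' : M.grading α') (n : N.grading β),
    pair (α + α') β ⟨M.bracket m.1 m'.1, M.bracket_grading α α' m.1 m'.1 m.2 m'.2⟩ n
      = pair α (α' + β) m ⟨aMN.act m'.1 n.1, aMN.act_grading α' β m'.1 n.1 m'.2 n.2⟩
        - ssign α α' • pair α' (α + β) m' ⟨aMN.act m.1 n.1, aMN.act_grading α β m.1 n.1 m.2 n.2⟩
  pair_bracket_right : ∀ (α β β' : ZMod 2) (m : M.grading α) (n : N.grading β) (n' : N.grading β'),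
    pair α (β + β') m ⟨N.bracket n.1 n'.1, N.bracket_grading β β' n.1 n'.1 n.2 n'.2⟩
      = ssign β' (α + β) • pair (β' + α) β
          ⟨aNM.act n'.1 m.1, aNM.act_grading β' α n'.1 m.1 n'.2 m.2⟩ n
        - ssign α β • pair (β + α) β'
          ⟨aNM.act n.1 m.1, aNM.act_grading β α n.1 m.1 n.2 m.2⟩ n'
  pair_bracket_pair : ∀ (α β α' β' : ZMod 2) (m : M.grading α) (n : N.grading β)
      (m' : M.grading α') (n' : N.grading β'),
    Q.bracket (pair α β m n) (pair α' β' m' n')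
      = -(ssign α β • pair (β + α) (α' + β')
          ⟨aNM.act n.1 m.1, aNM.act_grading β α n.1 m.1 n.2 m.2⟩
          ⟨aMN.act m'.1 n'.1, aMN.act_grading α' β' m'.1 n'.1 m'.2 n'.2⟩)

/-- `(T, ι)` is *the* non-abelian tensor product `M ⊗ N`: it is initial among Lie
superalgebras equipped with tensor symbols satisfying the defining relations.  This
universal property characterizes the Lie superalgebra presented by the generators
`m ⊗ n` and the relations of the non-abelian tensor product, uniquely up to isomorphism. -/
def IsNATensor {M N : LieSuperalgebra K} (aMN : LieSuperAction M N) (aNM : LieSuperAction N M)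
    (T : LieSuperalgebra K) (ι : TensorData aMN aNM T) : Prop :=
  ∀ (Q : LieSuperalgebra K) (d : TensorData aMN aNM Q),
    ∃! f : LieSuperHom T Q,
      ∀ (α β : ZMod 2) (m : M.grading α) (n : N.grading β),
        f.toLinear (ι.pair α β m n) = d.pair α β m n

/-- Tensor-symbol data additionally satisfying the relations of the non-abelian
exterior square `L ∧ L` (relative to an action `a` of `L` on itself). -/
structure ExtSqData {L : LieSuperalgebra K} (a : LieSuperAction L L) (Q : LieSuperalgebra K)
    extends TensorData a a Q where
  pair_alt : ∀ (α β : ZMod 2) (x : L.grading α) (y : L.grading β),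
    toTensorData.pair α β x y + ssign α β • toTensorData.pair β α y x = 0
  pair_self : ∀ x : L.grading 0, toTensorData.pair 0 0 x x = 0

/-- `(E, ι)` is the non-abelian exterior square `L ∧ L`. -/
def IsNAExtSq {L : LieSuperalgebra K} (a : LieSuperAction L L) (E : LieSuperalgebra K)
    (ι : ExtSqData a E) : Prop :=
  ∀ (Q : LieSuperalgebra K) (d : ExtSqData a Q),
    ∃! f : LieSuperHom E Q,
      ∀ (α β : ZMod 2) (x : L.grading α) (y : L.grading β),
        f.toLinear (ι.pair α β x y) = d.pair α β x y

/-- Generating family for a free Lie superalgebra on a graded set. -/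
structure FreeData (X : Type) (degX : X → ZMod 2) (F : LieSuperalgebra K) where
  gen : X → F.carrier
  gen_grading : ∀ x, gen x ∈ F.grading (degX x)

/-- `F` (with generators `i`) is the free Lie superalgebra on the graded set `(X, degX)`. -/
def IsFreeLieSuper {X : Type} (degX : X → ZMod 2) (F : LieSuperalgebra K)
    (i : FreeData X degX F) : Prop :=
  ∀ (M : LieSuperalgebra K) (j : FreeData X degX M),
    ∃! h : LieSuperHom F M, ∀ x, h.toLinear (i.gen x) = j.gen x

/-- The submodule spanned by brackets `[S, T]`. -/
def bracketSpan (L : LieSuperalgebra K) (S T : Submodule K L.carrier) :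
    Submodule K L.carrier :=
  Submodule.span K {z | ∃ x ∈ S, ∃ y ∈ T, z = L.bracket x y}

/-- Lower central series of a (sub-)Lie superalgebra `S ⊆ L`: `lcs 0 = S`,
`lcs (n+1) = [S, lcs n]`.  `S` is nilpotent of class `≤ c` iff `lcs c = ⊥`. -/
def lcs (L : LieSuperalgebra K) (S : Submodule K L.carrier) : ℕ → Submodule K L.carrier
  | 0 => S
  | n + 1 => bracketSpan L S (lcs L S n)

/-- Derived series of `S ⊆ L`.  `S` is solvable of derived length `≤ c` iff `ds c = ⊥`. -/
def ds (L : LieSuperalgebra K) (S : Submodule K L.carrier) : ℕ → Submodule K L.carrier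
  | 0 => S
  | n + 1 => bracketSpan L (ds L S n) (ds L S n)

/-- `S ⊆ L` is `n`-Engel: `ad(x)ⁿ = 0` on `S` for every `x ∈ S`. -/
def IsEngel (L : LieSuperalgebra K) (S : Submodule K L.carrier) (n : ℕ) : Prop :=
  ∀ x ∈ S, ∀ y ∈ S, ((L.bracket x) ^ n) y = 0

section Grading

variable {V W : Type} [AddCommGroup V] [Module K V] [AddCommGroup W] [Module K W]

/-- The induced grading on a submodule. -/
def gradeSub (g : ZMod 2 → Submodule K V) (S : Submodule K V) : ZMod 2 → Submodule K S :=
  fun α => (g α).comap S.subtype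

/-- The induced grading on a quotient module. -/
def gradeQuot (g : ZMod 2 → Submodule K V) (S : Submodule K V) : ZMod 2 → Submodule K (V ⧸ S) :=
  fun α => (g α).map S.mkQ

/-- The induced grading on a tensor product of supermodules. -/
def gradeTensor (gV : ZMod 2 → Submodule K V) (gW : ZMod 2 → Submodule K W) :
    ZMod 2 → Submodule K (V ⊗[K] W) :=
  fun γ => Submodule.span K {t | ∃ (α β : ZMod 2) (v : V) (w : W),
    α + β = γ ∧ v ∈ gV α ∧ w ∈ gW β ∧ t = v ⊗ₜ[K] w}

/-- A linear equivalence is an isomorphism of supermodules for the given gradings. -/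
def SuperEquiv (gV : ZMod 2 → Submodule K V) (gW : ZMod 2 → Submodule K W)
    (e : V ≃ₗ[K] W) : Prop :=
  ∀ α, (gV α).map e.toLinearMap = gW α

end Grading

/-- An associative (unital) superalgebra over `K`. -/
structure AssocSuperalgebra (K : Type) [CommRing K] : Type 1 where
  carrier : Type
  [isRing : Ring carrier]
  [isAlgebra : Algebra K carrier]
  grading : ZMod 2 → Submodule K carrier
  isInternal : DirectSum.IsInternal grading
  grading_mul : ∀ (α β : ZMod 2) (x y : carrier),
    x ∈ grading α → y ∈ grading β → x * y ∈ grading (α + β)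
  one_mem : (1 : carrier) ∈ grading 0

attribute [instance] AssocSuperalgebra.isRing AssocSuperalgebra.isAlgebra

/-- A (not necessarily unital) associative superalgebra over `K`. -/
structure NuAssocSuperalgebra (K : Type) [CommRing K] : Type 1 where
  carrier : Type
  [isRing : NonUnitalRing carrier]
  [isModule : Module K carrier]
  [isTower : IsScalarTower K carrier carrier]
  [isComm : SMulCommClass K carrier carrier]
  grading : ZMod 2 → Submodule K carrier
  isInternal : DirectSum.IsInternal grading
  grading_mul : ∀ (α β : ZMod 2) (x y : carrier),
    x ∈ grading α → y ∈ grading β → x * y ∈ grading (α + β)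

attribute [instance] NuAssocSuperalgebra.isRing NuAssocSuperalgebra.isModule
  NuAssocSuperalgebra.isTower NuAssocSuperalgebra.isComm

/-- The super-alternating relations inside `L ⊗ L`, whose quotient is `Λ²(L)`. -/
def altRel (L : LieSuperalgebra K) : Submodule K (L.carrier ⊗[K] L.carrier) :=
  Submodule.span K {t | ∃ (α β : ZMod 2) (x : L.grading α) (y : L.grading β),
    t = x.1 ⊗ₜ[K] y.1 + ssign α β • (y.1 ⊗ₜ[K] x.1)}

/-- The super-alternating relations inside `L ⊗ (L ⊗ L)`, whose quotient is `Λ³(L)`. -/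
def altRel3 (L : LieSuperalgebra K) :
    Submodule K (L.carrier ⊗[K] (L.carrier ⊗[K] L.carrier)) :=
  Submodule.span K
    ({t | ∃ (x : L.carrier) (r : L.carrier ⊗[K] L.carrier), r ∈ altRel L ∧ t = x ⊗ₜ[K] r} ∪
     {t | ∃ (α β : ZMod 2) (x : L.grading α) (y : L.grading β) (z : L.carrier),
        t = x.1 ⊗ₜ[K] (y.1 ⊗ₜ[K] z) + ssign α β • (y.1 ⊗ₜ[K] (x.1 ⊗ₜ[K] z))})


/-- The graded submodule `I(A) ⊆ A ⊗_K A` of the cyclic relations. -/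
def IA {K : Type} [CommRing K] (A : NuAssocSuperalgebra K) :
    Submodule K (A.carrier ⊗[K] A.carrier) :=
  Submodule.span K
    ({t | ∃ (α β : ZMod 2) (a : A.grading α) (b : A.grading β),
        t = a.1 ⊗ₜ[K] b.1 + ssign α β • (b.1 ⊗ₜ[K] a.1)} ∪
     {t | ∃ (α β γ : ZMod 2) (a : A.grading α) (b : A.grading β) (c : A.grading γ),
        t = (a.1 * b.1) ⊗ₜ[K] c.1 - a.1 ⊗ₜ[K] (b.1 * c.1)
            + ssign γ (α + β) • ((c.1 * a.1) ⊗ₜ[K] b.1)})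

/-- The graded submodule `J(A) ⊆ A ⊗_K A` of the Milnor relations, whose quotient is the
first Milnor cyclic homology `HC₁^M(A)`. -/
def JA {K : Type} [CommRing K] (A : NuAssocSuperalgebra K) :
    Submodule K (A.carrier ⊗[K] A.carrier) :=
  Submodule.span K
    ({t | ∃ (α β : ZMod 2) (a : A.grading α) (b : A.grading β),
        t = a.1 ⊗ₜ[K] b.1 + ssign α β • (b.1 ⊗ₜ[K] a.1)} ∪
     {t | ∃ (α β γ : ZMod 2) (a : A.grading α) (b : A.grading β) (c : A.grading γ),
        t = (a.1 * b.1) ⊗ₜ[K] c.1 - a.1 ⊗ₜ[K] (b.1 * c.1)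
            + ssign γ (α + β) • ((c.1 * a.1) ⊗ₜ[K] b.1)} ∪
     {t | ∃ (α β γ : ZMod 2) (a : A.grading α) (b : A.grading β) (c : A.grading γ),
        t = a.1 ⊗ₜ[K] (b.1 * c.1) - ssign β γ • (a.1 ⊗ₜ[K] (c.1 * b.1))})

/-- `[A,A]`: the graded submodule generated by the super-commutators. -/
def commSpan {K : Type} [CommRing K] (A : NuAssocSuperalgebra K) : Submodule K A.carrier :=
  Submodule.span K {x | ∃ (α β : ZMod 2) (a : A.grading α) (b : A.grading β),
    x = a.1 * b.1 - ssign α β • (b.1 * a.1)}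

/-- `[A,[A,A]]`. -/
def commSpan2 {K : Type} [CommRing K] (A : NuAssocSuperalgebra K)
    (brA : A.carrier →ₗ[K] A.carrier →ₗ[K] A.carrier) : Submodule K A.carrier :=
  Submodule.span K {x | ∃ (a : A.carrier), ∃ y ∈ commSpan A, x = brA a y}

/-- A unital associative superalgebra is in particular a possibly-non-unital one. -/
def AssocSuperalgebra.toNu {K : Type} [CommRing K] (A : AssocSuperalgebra K) :
    NuAssocSuperalgebra K where
  carrier := A.carrier
  grading := A.grading
  isInternal := A.isInternal
  grading_mul := A.grading_mul

section GradedProjections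

variable {V W : Type} [AddCommGroup V] [Module K V] [AddCommGroup W] [Module K W]

/-- A family of projections onto the components of a grading. -/
structure IsGradedProj (g : ZMod 2 → Submodule K V) (π : ∀ α, V →ₗ[K] g α) : Prop where
  sum_eq : ∀ v, ∑ α, (π α v : V) = v
  apply_self : ∀ α (v : g α), π α v = v
  apply_ne : ∀ α β (v : g β), α ≠ β → π α v = 0

theorem exists_isGradedProj {g : ZMod 2 → Submodule K V} (hg : DirectSum.IsInternal g) :
    ∃ π, IsGradedProj g π := by
  let e := LinearEquiv.ofBijective (DirectSum.coeLinearMap g) hg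
  have he : ∀ α (v : g α), e.symm v = DirectSum.lof K _ (fun i => g i) α v := by
    intro α v
    rw [LinearEquiv.symm_apply_eq]
    exact (DirectSum.coeLinearMap_lof g α v).symm
  refine ⟨fun α => DirectSum.component K _ (fun i => g i) α ∘ₗ e.symm.toLinearMap, ?_, ?_, ?_⟩
  · intro v
    obtain ⟨x, rfl⟩ := e.surjective v
    induction x using DirectSum.induction_on with
    | zero => simp
    | add x y hx hy => simp only [map_add, Submodule.coe_add, Finset.sum_add_distrib, hx, hy]
    | of i x =>
      rw [Finset.sum_eq_single i]
      · simp only [LinearMap.comp_apply, LinearEquiv.coe_coe, LinearEquiv.symm_apply_apply]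
        change ((DirectSum.of (fun i => g i) i x) i : V) = e _
        rw [DirectSum.of_eq_same]
        exact (DirectSum.coeLinearMap_lof g i x).symm
      · intro j _ hj
        simp only [LinearMap.comp_apply, LinearEquiv.coe_coe, LinearEquiv.symm_apply_apply]
        change ((DirectSum.of (fun i => g i) i x) j : V) = 0
        rw [DirectSum.of_eq_of_ne _ _ _ hj]
        rfl
      · simp
  · intro α v
    simp only [LinearMap.comp_apply, LinearEquiv.coe_coe, he]
    exact DirectSum.of_eq_same (β := fun i => g i) α v
  · intro α β v h
    simp only [LinearMap.comp_apply, LinearEquiv.coe_coe, he]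
    exact DirectSum.of_eq_of_ne _ _ _ h

theorem IsGradedProj.isInternal {g : ZMod 2 → Submodule K V} {π : ∀ α, V →ₗ[K] g α}
    (h : IsGradedProj g π) : DirectSum.IsInternal g := by
  constructor
  · have key : ∀ (x : DirectSum (ZMod 2) (fun i => g i)) α,
        π α (DirectSum.coeLinearMap g x) = x α := by
      intro x α
      induction x using DirectSum.induction_on with
      | zero => simp
      | add x y hx hy => simp only [map_add, hx, hy, DirectSum.add_apply]
      | of i x =>
        have hi : DirectSum.coeLinearMap g (DirectSum.of (fun i => g i) i x) = x :=
          DirectSum.coeLinearMap_lof g i x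
        rw [hi]
        by_cases hα : α = i
        · subst hα
          rw [h.apply_self, DirectSum.of_eq_same]
        · rw [h.apply_ne _ _ _ hα, DirectSum.of_eq_of_ne _ _ _ hα]
    intro x y hxy
    refine DirectSum.ext_component K (fun α => ?_)
    change x α = y α
    rw [← key x α, ← key y α]
    exact congrArg _ hxy
  · intro v
    refine ⟨∑ α, DirectSum.of (fun i => g i) α (π α v), ?_⟩
    rw [map_sum]
    conv_rhs => rw [← h.sum_eq v]
    refine Finset.sum_congr rfl fun α _ => ?_
    exact DirectSum.coeLinearMap_lof g α (π α v)

theorem isInternal_of_linearMap {g : ZMod 2 → Submodule K V} (π : ZMod 2 → V →ₗ[K] V)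
    (hmem : ∀ α v, π α v ∈ g α) (hsum : ∀ v, ∑ α, π α v = v)
    (hself : ∀ α, ∀ v ∈ g α, π α v = v) (hne : ∀ α β, α ≠ β → ∀ v ∈ g β, π α v = 0) :
    DirectSum.IsInternal g :=
  IsGradedProj.isInternal (π := fun α => (π α).codRestrict (g α) (hmem α))
    ⟨hsum, fun α v => Subtype.ext (hself α v v.2),
      fun α β v h => Subtype.ext (hne α β h v v.2)⟩

/-- A submodule containing all homogeneous elements contains every element. -/
theorem mem_of_homogeneous {g : ZMod 2 → Submodule K V} (hg : DirectSum.IsInternal g)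
    {S : Submodule K V} (hS : ∀ α, g α ≤ S) (v : V) : v ∈ S := by
  obtain ⟨π, h⟩ := exists_isGradedProj hg
  rw [← h.sum_eq v]
  exact Submodule.sum_mem _ fun α _ => hS α (π α v).2

theorem IsGradedProj.mem_span {g : ZMod 2 → Submodule K V} {π : ∀ α, V →ₗ[K] g α}
    (h : IsGradedProj g π) {s : Set V} (hs : ∀ x ∈ s, ∃ α, x ∈ g α) (α : ZMod 2) {v : V}
    (hv : v ∈ Submodule.span K s) : (π α v : V) ∈ Submodule.span K s := by
  induction hv using Submodule.span_induction with
  | zero => simp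
  | add x y _ _ hx hy => simpa using Submodule.add_mem _ hx hy
  | smul c x _ hx => simpa using Submodule.smul_mem _ c hx
  | mem x hx =>
    obtain ⟨β, hβ⟩ := hs x hx
    by_cases hα : α = β
    · subst hα
      rw [h.apply_self α ⟨x, hβ⟩]
      exact Submodule.subset_span hx
    · rw [h.apply_ne α β ⟨x, hβ⟩ hα]
      simp

theorem isInternal_gradeSub_span {g : ZMod 2 → Submodule K V} (hg : DirectSum.IsInternal g)
    {s : Set V} (hs : ∀ x ∈ s, ∃ α, x ∈ g α) :
    DirectSum.IsInternal (gradeSub g (Submodule.span K s)) := by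
  obtain ⟨π, h⟩ := exists_isGradedProj hg
  refine isInternal_of_linearMap
    (fun α => ((g α).subtype ∘ₗ π α).restrict fun v hv => h.mem_span hs α hv) ?_ ?_ ?_ ?_
  · exact fun α v => (π α v).2
  · intro v
    refine Subtype.ext ?_
    rw [AddSubmonoidClass.coe_finsetSum]
    exact h.sum_eq v
  · exact fun α v hv => Subtype.ext (congrArg (fun x : g α => (x : V)) (h.apply_self α ⟨v, hv⟩))
  · exact fun α β hne v hv =>
      Subtype.ext (congrArg (fun x : g α => (x : V)) (h.apply_ne α β ⟨v, hv⟩ hne))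

theorem isInternal_gradeQuot_span {g : ZMod 2 → Submodule K V} (hg : DirectSum.IsInternal g)
    {s : Set V} (hs : ∀ x ∈ s, ∃ α, x ∈ g α) :
    DirectSum.IsInternal (gradeQuot g (Submodule.span K s)) := by
  obtain ⟨π, h⟩ := exists_isGradedProj hg
  refine isInternal_of_linearMap
    (fun α => Submodule.mapQ _ _ ((g α).subtype ∘ₗ π α) fun v hv => h.mem_span hs α hv) ?_ ?_ ?_ ?_
  · intro α v
    obtain ⟨v, rfl⟩ := Submodule.mkQ_surjective _ v
    exact ⟨_, (π α v).2, rfl⟩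
  · intro v
    obtain ⟨v, rfl⟩ := Submodule.mkQ_surjective _ v
    conv_rhs => rw [← h.sum_eq v, map_sum]
    rfl
  · rintro α _ ⟨v, hv, rfl⟩
    exact congrArg (fun x : g α => Submodule.mkQ _ (x : V)) (h.apply_self α ⟨v, hv⟩)
  · rintro α β hne _ ⟨v, hv, rfl⟩
    exact (congrArg (fun x : g α => Submodule.mkQ _ (x : V)) (h.apply_ne α β ⟨v, hv⟩ hne)).trans
      (map_zero _)

theorem isInternal_gradeTensor {gV : ZMod 2 → Submodule K V} {gW : ZMod 2 → Submodule K W}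
    (hV : DirectSum.IsInternal gV) (hW : DirectSum.IsInternal gW) :
    DirectSum.IsInternal (gradeTensor gV gW) := by
  obtain ⟨π, h⟩ := exists_isGradedProj hV
  obtain ⟨ρ, h'⟩ := exists_isGradedProj hW
  let σ : ZMod 2 → V ⊗[K] W →ₗ[K] V ⊗[K] W := fun γ =>
    ∑ α, TensorProduct.map ((gV α).subtype ∘ₗ π α) ((gW (γ - α)).subtype ∘ₗ ρ (γ - α))
  have hσ : ∀ γ v w, σ γ (v ⊗ₜ w) = ∑ α, (π α v : V) ⊗ₜ[K] (ρ (γ - α) w : W) := by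
    intro γ v w
    simp [σ, LinearMap.sum_apply]
  have hhom : ∀ γ α β v w, v ∈ gV α → w ∈ gW β →
      σ γ (v ⊗ₜ w) = if γ = α + β then v ⊗ₜ w else 0 := by
    intro γ α β v w hv hw
    rw [hσ, Finset.sum_eq_single α]
    · rw [h.apply_self α ⟨v, hv⟩]
      split_ifs with hγ
      · obtain rfl : β = γ - α := by rw [hγ]; abel
        rw [h'.apply_self _ ⟨w, hw⟩]
      · rw [h'.apply_ne _ β ⟨w, hw⟩ (fun hβ => hγ (by rw [← hβ]; abel))]
        simp
    · intro α' _ hne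
      rw [h.apply_ne _ _ ⟨v, hv⟩ hne]
      simp
    · simp
  refine isInternal_of_linearMap σ ?_ ?_ ?_ ?_
  · intro γ t
    induction t with
    | zero => simp
    | add x y hx hy => rw [map_add]; exact Submodule.add_mem _ hx hy
    | tmul v w =>
      rw [hσ]
      exact Submodule.sum_mem _ fun α _ => Submodule.subset_span
        ⟨α, γ - α, _, _, by abel, (π α v).2, (ρ (γ - α) w).2, rfl⟩
  · intro t
    induction t with
    | zero => simp
    | add x y hx hy => simp only [map_add, Finset.sum_add_distrib, hx, hy]
    | tmul v w =>
      simp only [hσ]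
      rw [Finset.sum_comm]
      conv_rhs => rw [← h.sum_eq v, TensorProduct.sum_tmul]
      refine Finset.sum_congr rfl fun α _ => ?_
      rw [← TensorProduct.tmul_sum]
      congr 1
      conv_rhs => rw [← h'.sum_eq w]
      exact Fintype.sum_equiv (Equiv.subRight α) _ _ fun _ => rfl
  · intro γ t ht
    refine Submodule.span_induction (p := fun t _ => σ γ t = t) ?_ (map_zero _) ?_ ?_ ht
    · rintro _ ⟨α, β, v, w, hγ, hv, hw, rfl⟩
      rw [hhom γ α β v w hv hw, if_pos hγ.symm]
    · intro x y _ _ hx hy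
      rw [map_add, hx, hy]
    · intro c x _ hx
      rw [map_smul, hx]
  · intro γ δ hne t ht
    refine Submodule.span_induction (p := fun t _ => σ γ t = 0) ?_ (map_zero _) ?_ ?_ ht
    · rintro _ ⟨α, β, v, w, hγ, hv, hw, rfl⟩
      rw [hhom γ α β v w hv hw, if_neg (fun h => hne (h.trans hγ))]
    · intro x y _ _ hx hy
      rw [map_add, hx, hy, add_zero]
    · intro c x _ hx
      rw [map_smul, hx, smul_zero]

theorem isInternal_map_equiv {g : ZMod 2 → Submodule K V} (hg : DirectSum.IsInternal g)
    {gW : ZMod 2 → Submodule K W} (e : V ≃ₗ[K] W) (he : SuperEquiv g gW e) :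
    DirectSum.IsInternal gW := by
  obtain ⟨π, h⟩ := exists_isGradedProj hg
  have key : ∀ α, ∀ w ∈ gW α, e.symm w ∈ g α := by
    intro α w hw
    rw [← he α] at hw
    obtain ⟨v, hv, rfl⟩ := hw
    simpa using hv
  refine isInternal_of_linearMap
    (fun α => e.toLinearMap ∘ₗ ((g α).subtype ∘ₗ π α) ∘ₗ e.symm.toLinearMap) ?_ ?_ ?_ ?_
  · intro α w
    rw [← he α]
    exact ⟨_, (π α (e.symm w)).2, rfl⟩
  · intro w
    conv_rhs => rw [← e.apply_symm_apply w, ← h.sum_eq (e.symm w), map_sum]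
    rfl
  · intro α w hw
    have := congrArg (fun x : g α => e (x : V)) (h.apply_self α ⟨_, key α w hw⟩)
    exact this.trans (e.apply_symm_apply w)
  · intro α β hne w hw
    have := congrArg (fun x : g α => e (x : V)) (h.apply_ne α β ⟨_, key β w hw⟩ hne)
    exact this.trans (map_zero e)

end GradedProjections

/-- The abelian Lie superalgebra on a supermodule. -/
abbrev LieSuperalgebra.abelian {V : Type} [AddCommGroup V] [Module K V]
    (g : ZMod 2 → Submodule K V) (hg : DirectSum.IsInternal g) : LieSuperalgebra K where
  carrier := V
  grading := g
  isInternal := hg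
  bracket := 0
  bracket_grading := by simp
  super_skew := by simp
  super_jacobi := by simp
  bracket_self_even := by simp

/-- A graded submodule closed under the bracket, as a Lie superalgebra. -/
def LieSuperalgebra.ofSubmodule (L : LieSuperalgebra K) (S : Submodule K L.carrier)
    (hS : DirectSum.IsInternal (gradeSub L.grading S))
    (hbr : ∀ x ∈ S, ∀ y ∈ S, L.bracket x y ∈ S) : LieSuperalgebra K where
  carrier := S
  grading := gradeSub L.grading S
  isInternal := hS
  bracket := LinearMap.mk₂ K (fun x y => ⟨L.bracket x y, hbr x x.2 y y.2⟩)
    (fun _ _ _ => Subtype.ext (by simp)) (fun _ _ _ => Subtype.ext (by simp))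
    (fun _ _ _ => Subtype.ext (by simp)) (fun _ _ _ => Subtype.ext (by simp))
  bracket_grading α β x y hx hy := L.bracket_grading α β x y hx hy
  super_skew α β x y hx hy := Subtype.ext (L.super_skew α β x y hx hy)
  super_jacobi α β x y hx hy z := Subtype.ext (L.super_jacobi α β x y hx hy z)
  bracket_self_even x hx := Subtype.ext (L.bracket_self_even x hx)

namespace TensorData

variable {M N : LieSuperalgebra K} {aMN : LieSuperAction M N} {aNM : LieSuperAction N M}
  {T : LieSuperalgebra K}

/-- The set of tensor symbols. -/
def symbols (ι : TensorData aMN aNM T) : Set T.carrier :=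
  {t | ∃ (α β : ZMod 2) (m : M.grading α) (n : N.grading β), t = ι.pair α β m n}

theorem pair_mem_span (ι : TensorData aMN aNM T) (α β : ZMod 2) (m : M.grading α)
    (n : N.grading β) : ι.pair α β m n ∈ Submodule.span K ι.symbols :=
  Submodule.subset_span ⟨α, β, m, n, rfl⟩

theorem bracket_mem_span (ι : TensorData aMN aNM T) :
    ∀ x ∈ Submodule.span K ι.symbols, ∀ y ∈ Submodule.span K ι.symbols,
      T.bracket x y ∈ Submodule.span K ι.symbols := by
  intro x hx y hy
  refine LinearMap.BilinMap.apply_apply_mem_of_mem_span (Submodule.span K ι.symbols)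
    ι.symbols ι.symbols T.bracket ?_ x y hx hy
  rintro _ ⟨α, β, m, n, rfl⟩ _ ⟨α', β', m', n', rfl⟩
  rw [ι.pair_bracket_pair]
  exact Submodule.neg_mem _ (zsmul_mem (ι.pair_mem_span _ _ _ _) _)

theorem isInternal_span (ι : TensorData aMN aNM T) :
    DirectSum.IsInternal (gradeSub T.grading (Submodule.span K ι.symbols)) :=
  isInternal_gradeSub_span T.isInternal <| by
    rintro _ ⟨α, β, m, n, rfl⟩
    exact ⟨α + β, ι.pair_grading α β m n⟩

/-- Tensor symbols regarded in the Lie superalgebra they span. -/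
def restrictSpan (ι : TensorData aMN aNM T) :
    TensorData aMN aNM (T.ofSubmodule _ ι.isInternal_span ι.bracket_mem_span) where
  pair α β m n := ⟨ι.pair α β m n, ι.pair_mem_span α β m n⟩
  pair_grading := ι.pair_grading
  pair_smul_left α β c m n := Subtype.ext (ι.pair_smul_left α β c m n)
  pair_smul_right α β c m n := Subtype.ext (ι.pair_smul_right α β c m n)
  pair_add_left α β m m' n := Subtype.ext (ι.pair_add_left α β m m' n)
  pair_add_right α β m n n' := Subtype.ext (ι.pair_add_right α β m n n')
  pair_bracket_left α α' β m m' n := Subtype.ext (ι.pair_bracket_left α α' β m m' n)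
  pair_bracket_right α β β' m n n' := Subtype.ext (ι.pair_bracket_right α β β' m n n')
  pair_bracket_pair α β α' β' m n m' n' :=
    Subtype.ext (ι.pair_bracket_pair α β α' β' m n m' n')

/-- The bilinear map on homogeneous components underlying the tensor symbols. -/
def pairLin (ι : TensorData aMN aNM T) (α β : ZMod 2) :
    M.grading α →ₗ[K] N.grading β →ₗ[K] T.carrier :=
  LinearMap.mk₂ K (ι.pair α β) (ι.pair_add_left α β) (ι.pair_smul_left α β)
    (ι.pair_add_right α β) (ι.pair_smul_right α β)

theorem pair_zero_right (ι : TensorData aMN aNM T) (α β : ZMod 2) (m : M.grading α) :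
    ι.pair α β m 0 = 0 :=
  map_zero (ι.pairLin α β m)

theorem exists_bilinear (ι : TensorData aMN aNM T) :
    ∃ B : M.carrier →ₗ[K] N.carrier →ₗ[K] T.carrier,
      ∀ (α β : ZMod 2) (m : M.grading α) (n : N.grading β), B m n = ι.pair α β m n := by
  obtain ⟨π, h⟩ := exists_isGradedProj M.isInternal
  obtain ⟨ρ, h'⟩ := exists_isGradedProj N.isInternal
  refine ⟨∑ α, ∑ β, (ι.pairLin α β).compl₁₂ (π α) (ρ β), fun α β m n => ?_⟩
  simp only [LinearMap.sum_apply, LinearMap.compl₁₂_apply]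
  rw [Finset.sum_eq_single α, Finset.sum_eq_single β]
  · rw [h.apply_self, h'.apply_self]
    rfl
  · intro β' _ hne
    rw [h'.apply_ne _ _ _ hne, map_zero]
  · simp
  · intro α' _ hne
    simp [h.apply_ne _ _ m hne]
  · simp

/-- Tensor symbols with values in an abelian Lie superalgebra, for trivial actions on an abelian
Lie superalgebra `N`. -/
def ofTrivial {Q : LieSuperalgebra K} (hMN : aMN.act = 0) (hNM : aNM.act = 0)
    (hN : ∀ x y, N.bracket x y = 0) (hQ : ∀ x y, Q.bracket x y = 0)
    (B : M.carrier →ₗ[K] N.carrier →ₗ[K] Q.carrier)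
    (hBgr : ∀ (α β : ZMod 2) (m : M.grading α) (n : N.grading β), B m n ∈ Q.grading (α + β))
    (hB : ∀ x y n, B (M.bracket x y) n = 0) : TensorData aMN aNM Q where
  pair _ _ m n := B m n
  pair_grading := hBgr
  pair_smul_left := by simp
  pair_smul_right := by simp
  pair_add_left := by simp
  pair_add_right := by simp
  pair_bracket_left := by simp [hMN, hB]
  pair_bracket_right := by simp [hNM, hN]
  pair_bracket_pair := by simp [hNM, hQ]

end TensorData

theorem IsNATensor.span_eq_top {M N : LieSuperalgebra K} {aMN : LieSuperAction M N}
    {aNM : LieSuperAction N M} {T : LieSuperalgebra K} {ι : TensorData aMN aNM T}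
    (h : IsNATensor aMN aNM T ι) : Submodule.span K ι.symbols = ⊤ := by
  obtain ⟨f, hf, -⟩ := h _ ι.restrictSpan
  let inclf : LieSuperHom T T :=
    { toLinear := (Submodule.span K ι.symbols).subtype ∘ₗ f.toLinear
      map_grading := fun α x hx => f.map_grading α x hx
      map_bracket := fun x y => congrArg Subtype.val (f.map_bracket x y) }
  let idT : LieSuperHom T T :=
    { toLinear := LinearMap.id
      map_grading := fun _ _ hx => hx
      map_bracket := fun _ _ => rfl }
  have heq : inclf = idT := (h T ι).unique
    (fun α β m n => congrArg Subtype.val (hf α β m n)) (fun _ _ _ _ => rfl)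
  refine eq_top_iff.2 fun x _ => ?_
  have hx : inclf.toLinear x = x := by rw [heq]; rfl
  rw [← hx]
  exact (f.toLinear x).2

/-- The range of a map out of a tensor product that sends symbols to an action. -/
theorem IsNATensor.range_eq_span_act {M N : LieSuperalgebra K} {aMN : LieSuperAction M N}
    {aNM : LieSuperAction N M} {T : LieSuperalgebra K} {ι : TensorData aMN aNM T}
    (h : IsNATensor aMN aNM T ι) (ν : T.carrier →ₗ[K] N.carrier)
    (hν : ∀ (α β : ZMod 2) (m : M.grading α) (n : N.grading β),
      ν (ι.pair α β m n) = aMN.act m.1 n.1) :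
    LinearMap.range ν = Submodule.span K {x | ∃ m n, x = aMN.act m n} := by
  apply le_antisymm
  · rw [LinearMap.range_eq_map, ← h.span_eq_top, Submodule.map_span_le]
    rintro _ ⟨α, β, m, n, rfl⟩
    rw [hν]
    exact Submodule.subset_span ⟨m, n, rfl⟩
  · rw [Submodule.span_le]
    rintro _ ⟨m, n, rfl⟩
    have hm : ∀ m, m ∈ ⨅ n, (LinearMap.range ν).comap (aMN.act.flip n) := by
      refine mem_of_homogeneous M.isInternal fun α m hm => ?_
      rw [Submodule.mem_iInf]
      refine mem_of_homogeneous N.isInternal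
        (S := (LinearMap.range ν).comap (aMN.act m)) fun β n hn => ?_
      exact ⟨_, hν α β ⟨m, hm⟩ ⟨n, hn⟩⟩
    exact (Submodule.mem_iInf _).1 (hm m) n

/-- The tensor product of Lie superalgebras `M` and `N` acting trivially on each other, with `N`
abelian, is the tensor product of supermodules of the abelianization of `M` with `N`. -/
theorem IsNATensor.exists_superEquiv_of_trivial {M N : LieSuperalgebra K}
    {aMN : LieSuperAction M N} {aNM : LieSuperAction N M} {T : LieSuperalgebra K}
    {ι : TensorData aMN aNM T} (h : IsNATensor aMN aNM T ι) (hMN : aMN.act = 0)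
    (hNM : aNM.act = 0) (hN : ∀ x y, N.bracket x y = 0)
    {V W : Type} [AddCommGroup V] [Module K V] [AddCommGroup W] [Module K W]
    {gV : ZMod 2 → Submodule K V} {gW : ZMod 2 → Submodule K W}
    (hV : DirectSum.IsInternal gV) (p : M.carrier →ₗ[K] V) (hp : Function.Surjective p)
    (hpg : ∀ α, (M.grading α).map p = gV α)
    (hpbr : ∀ x y, p (M.bracket x y) = 0)
    (hker : LinearMap.ker p ≤ Submodule.span K {z | ∃ (α β : ZMod 2) (x : M.grading α)
      (y : M.grading β), z = M.bracket x.1 y.1})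
    (e : N.carrier ≃ₗ[K] W) (he : SuperEquiv N.grading gW e) :
    ∃ E : T.carrier ≃ₗ[K] V ⊗[K] W, SuperEquiv T.grading (gradeTensor gV gW) E ∧
      ∀ (α β : ZMod 2) (m : M.grading α) (n : N.grading β),
        E (ι.pair α β m n) = p m ⊗ₜ[K] e n := by
  have hpmem : ∀ {α} (m : M.grading α), p m ∈ gV α := fun {α} m =>
    hpg α ▸ Submodule.mem_map_of_mem m.2
  have hemem : ∀ {α} (n : N.grading α), e n ∈ gW α := fun {α} n =>
    he α ▸ Submodule.mem_map_of_mem (f := e.toLinearMap) n.2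
  obtain ⟨f, hfgr, hf⟩ : ∃ f : T.carrier →ₗ[K] V ⊗[K] W,
      (∀ α, ∀ t ∈ T.grading α, f t ∈ gradeTensor gV gW α) ∧
      ∀ (α β : ZMod 2) (m : M.grading α) (n : N.grading β),
        f (ι.pair α β m n) = p m ⊗ₜ[K] e n := by
    obtain ⟨f, hf, -⟩ := h
      (LieSuperalgebra.abelian (gradeTensor gV gW)
        (isInternal_gradeTensor hV (isInternal_map_equiv N.isInternal e he)))
      (TensorData.ofTrivial hMN hNM hN (fun _ _ => rfl)
        ((TensorProduct.mk K V W).compl₁₂ p e.toLinearMap)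
        (fun α β m n => Submodule.subset_span ⟨α, β, _, _, rfl, hpmem m, hemem n, rfl⟩)
        (fun m m' n => (congrArg (· ⊗ₜ[K] e n) (hpbr m m')).trans (TensorProduct.zero_tmul _ _)))
    exact ⟨f.toLinear, f.map_grading, hf⟩
  obtain ⟨B, hB⟩ := ι.exists_bilinear
  have hBker : LinearMap.ker p ≤ LinearMap.ker B := by
    refine hker.trans (Submodule.span_le.2 ?_)
    rintro _ ⟨α, α', m, m', rfl⟩
    refine LinearMap.ext fun n => ?_
    refine mem_of_homogeneous N.isInternal
      (S := LinearMap.ker (B (M.bracket m.1 m'.1))) (fun β n hn => ?_) n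
    rw [LinearMap.mem_ker]
    refine (hB (α + α') β ⟨_, M.bracket_grading α α' _ _ m.2 m'.2⟩ ⟨n, hn⟩).trans ?_
    have hzero : ∀ γ δ (x : M.grading γ) (y : N.carrier) (hy : y ∈ N.grading δ), y = 0 →
        ι.pair γ δ x ⟨y, hy⟩ = 0 := by
      rintro γ δ x y hy rfl
      exact ι.pair_zero_right γ δ x
    rw [ι.pair_bracket_left α α' β m m' ⟨n, hn⟩, hzero _ _ _ _ _ (by simp [hMN]),
      hzero _ _ _ _ _ (by simp [hMN]), smul_zero, sub_zero]
  let g : V ⊗[K] W →ₗ[K] T.carrier := TensorProduct.lift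
    ((((LinearMap.ker p).liftQ B hBker) ∘ₗ (p.quotKerEquivOfSurjective hp).symm.toLinearMap).compl₂
      e.symm.toLinearMap)
  have hg : ∀ m n, g (p m ⊗ₜ[K] e n) = B m n := by
    intro m n
    have : (p.quotKerEquivOfSurjective hp).symm (p m) = (LinearMap.ker p).mkQ m := by
      rw [LinearEquiv.symm_apply_eq]
      rfl
    simp [g, this]
  have hgf : g ∘ₗ f = LinearMap.id := by
    refine LinearMap.ext_on h.span_eq_top ?_
    rintro _ ⟨α, β, m, n, rfl⟩
    rw [LinearMap.comp_apply, hf]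
    exact (hg m n).trans (hB α β m n)
  have hfB : ∀ m n, f (B m n) = p m ⊗ₜ[K] e n := by
    intro m n
    let F := B.compr₂ f
    let G := (TensorProduct.mk K V W).compl₁₂ p e.toLinearMap
    change F m n = G m n
    refine LinearMap.congr_fun (f := F m) ?_ n
    refine mem_of_homogeneous M.isInternal (S := LinearMap.eqLocus F G) (fun α m hm => ?_) m
    refine LinearMap.ext fun n => ?_
    refine mem_of_homogeneous N.isInternal
      (S := LinearMap.eqLocus (F m) (G m)) (fun β n hn => ?_) n
    exact (congrArg f (hB α β ⟨m, hm⟩ ⟨n, hn⟩)).trans (hf α β ⟨m, hm⟩ ⟨n, hn⟩)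
  have hfg : f ∘ₗ g = LinearMap.id := by
    refine TensorProduct.ext' fun v w => ?_
    obtain ⟨m, rfl⟩ := hp v
    obtain ⟨n, rfl⟩ := e.surjective w
    exact (congrArg f (hg m n)).trans (hfB m n)
  refine ⟨LinearEquiv.ofLinearMap f g hfg hgf, fun α => le_antisymm ?_ ?_, hf⟩
  · rintro _ ⟨t, ht, rfl⟩
    exact hfgr α t ht
  · refine Submodule.span_le.2 ?_
    rintro _ ⟨β, γ, v, w, rfl, hv, hw, rfl⟩
    rw [← hpg β] at hv
    rw [← he γ] at hw
    obtain ⟨m, hm, rfl⟩ := hv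
    obtain ⟨n, hn, rfl⟩ := hw
    exact ⟨_, ι.pair_grading β γ ⟨m, hm⟩ ⟨n, hn⟩, hf β γ ⟨m, hm⟩ ⟨n, hn⟩⟩

section Commutators

variable {A : NuAssocSuperalgebra K} {brA : A.carrier →ₗ[K] A.carrier →ₗ[K] A.carrier}
  {c : A.carrier ⊗[K] A.carrier →ₗ[K] A.carrier}

theorem NuAssocSuperalgebra.commutator_mem (A : NuAssocSuperalgebra K) {α β : ZMod 2}
    {a b : A.carrier} (ha : a ∈ A.grading α) (hb : b ∈ A.grading β) :
    a * b - ssign α β • (b * a) ∈ A.grading (α + β) :=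
  sub_mem (A.grading_mul α β a b ha hb)
    (zsmul_mem (add_comm β α ▸ A.grading_mul β α b a hb ha) _)

theorem isInternal_gradeQuot_commSpan (A : NuAssocSuperalgebra K) :
    DirectSum.IsInternal (gradeQuot A.grading (commSpan A)) :=
  isInternal_gradeQuot_span A.isInternal <| by
    rintro _ ⟨α, β, a, b, rfl⟩
    exact ⟨α + β, A.commutator_mem a.2 b.2⟩

theorem bracket_mem_commSpan
    (hbrA : ∀ (α β : ZMod 2) (a : A.grading α) (b : A.grading β),
      brA a.1 b.1 = a.1 * b.1 - ssign α β • (b.1 * a.1)) (a b : A.carrier) :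
    brA a b ∈ commSpan A := by
  have ha : ∀ a, a ∈ ⨅ b, (commSpan A).comap (brA.flip b) := by
    refine mem_of_homogeneous A.isInternal fun α a ha => ?_
    rw [Submodule.mem_iInf]
    refine mem_of_homogeneous A.isInternal
      (S := (commSpan A).comap (brA a)) fun β b hb => ?_
    exact Submodule.subset_span ⟨α, β, ⟨a, ha⟩, ⟨b, hb⟩, hbrA α β ⟨a, ha⟩ ⟨b, hb⟩⟩
  exact (Submodule.mem_iInf _).1 (ha a) b

theorem IA_le_JA (A : NuAssocSuperalgebra K) : IA A ≤ JA A :=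
  Submodule.span_mono Set.subset_union_left

theorem tmul_bracket_mem_JA
    (hbrA : ∀ (α β : ZMod 2) (a : A.grading α) (b : A.grading β),
      brA a.1 b.1 = a.1 * b.1 - ssign α β • (b.1 * a.1))
    (hc : ∀ a b : A.carrier, c (a ⊗ₜ[K] b) = brA a b)
    (a : A.carrier) (w : A.carrier ⊗[K] A.carrier) : a ⊗ₜ[K] c w ∈ JA A := by
  let F := TensorProduct.mk K A.carrier A.carrier
  have key : ∀ a, a ∈ ⨅ w, (JA A).comap (F.flip (c w)) := by
    refine mem_of_homogeneous A.isInternal fun α a ha => ?_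
    rw [Submodule.mem_iInf]
    refine mem_of_homogeneous (isInternal_gradeTensor A.isInternal A.isInternal)
      (S := (JA A).comap (F a ∘ₗ c)) fun γ => ?_
    refine Submodule.span_le.2 ?_
    rintro _ ⟨β, γ, b, d, -, hb, hd, rfl⟩
    refine Submodule.subset_span (Or.inr ⟨α, β, γ, ⟨a, ha⟩, ⟨b, hb⟩, ⟨d, hd⟩, ?_⟩)
    change a ⊗ₜ[K] c (b ⊗ₜ[K] d) = _
    rw [hc, hbrA β γ ⟨b, hb⟩ ⟨d, hd⟩, TensorProduct.tmul_sub, TensorProduct.tmul_smul]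
  exact (Submodule.mem_iInf _).1 (key a) w

theorem map_mkQ_JA
    (hbrA : ∀ (α β : ZMod 2) (a : A.grading α) (b : A.grading β),
      brA a.1 b.1 = a.1 * b.1 - ssign α β • (b.1 * a.1))
    (hc : ∀ a b : A.carrier, c (a ⊗ₜ[K] b) = brA a b) :
    (JA A).map (IA A).mkQ
      = Submodule.span K {x | ∃ a w, x = (IA A).mkQ (a ⊗ₜ[K] c w)} := by
  apply le_antisymm
  · rw [JA, Submodule.map_span_le]
    rintro t (ht | ⟨α, β, γ, a, b, d, rfl⟩)
    · have : (IA A).mkQ t = 0 := by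
        rw [Submodule.mkQ_apply, Submodule.Quotient.mk_eq_zero]
        exact Submodule.subset_span ht
      rw [this]
      exact Submodule.zero_mem _
    · refine Submodule.subset_span ⟨a, b.1 ⊗ₜ[K] d.1, ?_⟩
      rw [hc, hbrA β γ b d, TensorProduct.tmul_sub, TensorProduct.tmul_smul]
  · rw [Submodule.span_le]
    rintro _ ⟨a, w, rfl⟩
    exact ⟨_, tmul_bracket_mem_JA hbrA hc a w, rfl⟩

end Commutators

/-- Computations of non-abelian homologies:
(i) `H̄₀(A, HC₁(A)) = HC₁(A)`; (ii) `H̄₁(A, HC₁(A)) ≅ (A/[A,A]) ⊗_K HC₁(A)`;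
(iii) `H̄₀(A, [A,A]) = [A,A]/[A,[A,A]]`; (iv) `H̄₀(A, V(A)) ≅ HC₁^M(A)`. -/
theorem statement13 {K : Type} [CommRing K] (A : NuAssocSuperalgebra K)
    -- the super-commutator bracket of `A`
    (brA : A.carrier →ₗ[K] A.carrier →ₗ[K] A.carrier)
    (hbrA : ∀ (α β : ZMod 2) (a : A.grading α) (b : A.grading β),
      brA a.1 b.1 = a.1 * b.1 - ssign α β • (b.1 * a.1))
    -- `A` regarded as a Lie superalgebra
    (LA : LieSuperalgebra K) (eA : LA.carrier ≃ₗ[K] A.carrier)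
    (hLAgr : ∀ γ : ZMod 2, (LA.grading γ).map eA.toLinearMap = A.grading γ)
    (hLAbr : ∀ x y : LA.carrier, eA (LA.bracket x y) = brA (eA x) (eA y))
    -- the linear map `A ⊗_K A → A`, `a ⊗ b ↦ [a,b]`
    (c : A.carrier ⊗[K] A.carrier →ₗ[K] A.carrier)
    (hc : ∀ a b : A.carrier, c (a ⊗ₜ[K] b) = brA a b)
    -- `V(A)`
    (VA : LieSuperalgebra K) (eV : VA.carrier ≃ₗ[K] (A.carrier ⊗[K] A.carrier ⧸ IA A))
    (hVgr : ∀ γ : ZMod 2, (VA.grading γ).map eV.toLinearMap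
      = gradeQuot (gradeTensor A.grading A.grading) (IA A) γ)
    (hVbr : ∀ w w' : A.carrier ⊗[K] A.carrier,
      eV (VA.bracket (eV.symm ((IA A).mkQ w)) (eV.symm ((IA A).mkQ w')))
        = (IA A).mkQ ((c w) ⊗ₜ[K] (c w')))
    (cbar : (A.carrier ⊗[K] A.carrier ⧸ IA A) →ₗ[K] A.carrier)
    (hcbar : ∀ w : A.carrier ⊗[K] A.carrier, cbar ((IA A).mkQ w) = c w)
    -- `HC₁(A)` regarded as an abelian Lie superalgebra
    (HL : LieSuperalgebra K) (eH : HL.carrier ≃ₗ[K] LinearMap.ker cbar)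
    (hHab : ∀ x y : HL.carrier, HL.bracket x y = 0)
    (hHgr : ∀ γ : ZMod 2, (HL.grading γ).map eH.toLinearMap
      = gradeSub (gradeQuot (gradeTensor A.grading A.grading) (IA A)) (LinearMap.ker cbar) γ)
    -- `[A,A]` regarded as a Lie superalgebra
    (CA : LieSuperalgebra K) (eC : CA.carrier ≃ₗ[K] commSpan A)
    (hCgr : ∀ γ : ZMod 2, (CA.grading γ).map eC.toLinearMap
      = gradeSub A.grading (commSpan A) γ)
    (hCbr : ∀ x y : CA.carrier, ((eC (CA.bracket x y)) : A.carrier)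
      = brA (eC x).1 (eC y).1)
    -- the crossed-module actions: `A` on `V(A)` and back,
    (a1 : LieSuperAction LA VA) (a2 : LieSuperAction VA LA)
    (ha1 : ∀ (x : LA.carrier) (w : A.carrier ⊗[K] A.carrier),
      a1.act x (eV.symm ((IA A).mkQ w)) = eV.symm ((IA A).mkQ ((eA x) ⊗ₜ[K] (c w))))
    (ha2 : ∀ (w : A.carrier ⊗[K] A.carrier) (x : LA.carrier),
      a2.act (eV.symm ((IA A).mkQ w)) x = eA.symm (brA (c w) (eA x)))
    -- `A` on `HC₁(A)` and back (both trivial),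
    (aLH : LieSuperAction LA HL) (htrivLH : aLH.act = 0)
    (aHL : LieSuperAction HL LA) (htrivHL : aHL.act = 0)
    -- `A` on `[A,A]` and back (via the inclusion)
    (aLC : LieSuperAction LA CA)
    (haLC : ∀ (x : LA.carrier) (y : CA.carrier),
      ((eC (aLC.act x y)) : A.carrier) = brA (eA x) (eC y).1)
    (aCL : LieSuperAction CA LA)
    (haCL : ∀ (y : CA.carrier) (x : LA.carrier),
      aCL.act y x = eA.symm (brA (eC y).1 (eA x)))
    -- the non-abelian tensor products `A ⊗ HC₁(A)`, `A ⊗ V(A)`, `A ⊗ [A,A]`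
    (T₁ : LieSuperalgebra K) (ι₁ : TensorData aLH aHL T₁) (h₁ : IsNATensor aLH aHL T₁ ι₁)
    (T₂ : LieSuperalgebra K) (ι₂ : TensorData a1 a2 T₂) (h₂ : IsNATensor a1 a2 T₂ ι₂)
    (T₃ : LieSuperalgebra K) (ι₃ : TensorData aLC aCL T₃) (h₃ : IsNATensor aLC aCL T₃ ι₃)
    -- and the corresponding homomorphisms `ν`
    (ν₁ : LieSuperHom T₁ HL)
    (hν₁ : ∀ (α β : ZMod 2) (p : LA.grading α) (v : HL.grading β),
      ν₁.toLinear (ι₁.pair α β p v) = aLH.act p.1 v.1)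
    (ν₂ : LieSuperHom T₂ VA)
    (hν₂ : ∀ (α β : ZMod 2) (p : LA.grading α) (v : VA.grading β),
      ν₂.toLinear (ι₂.pair α β p v) = a1.act p.1 v.1)
    (ν₃ : LieSuperHom T₃ CA)
    (hν₃ : ∀ (α β : ZMod 2) (p : LA.grading α) (v : CA.grading β),
      ν₃.toLinear (ι₃.pair α β p v) = aLC.act p.1 v.1) :
    -- (i) `H̄₀(A, HC₁(A)) = HC₁(A)`
    LinearMap.range ν₁.toLinear = ⊥ ∧
    -- (ii) `H̄₁(A, HC₁(A)) ≅ (A/[A,A]) ⊗_K HC₁(A)`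
    (∃ e : (LinearMap.ker ν₁.toLinear : Submodule K T₁.carrier) ≃ₗ[K]
        (A.carrier ⧸ commSpan A) ⊗[K] LinearMap.ker cbar,
      SuperEquiv (gradeSub T₁.grading (LinearMap.ker ν₁.toLinear))
        (gradeTensor (gradeQuot A.grading (commSpan A))
          (gradeSub (gradeQuot (gradeTensor A.grading A.grading) (IA A))
            (LinearMap.ker cbar))) e ∧
      ∀ (α β : ZMod 2) (p : LA.grading α) (v : HL.grading β),
        e ⟨ι₁.pair α β p v, by
            simp [LinearMap.mem_ker, hν₁ α β p v, htrivLH]⟩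
          = ((commSpan A).mkQ (eA p.1)) ⊗ₜ[K] (eH v.1)) ∧
    -- (iii) `H̄₀(A, [A,A]) = [A,A]/[A,[A,A]]`
    Submodule.map (commSpan A).subtype
      ((LinearMap.range ν₃.toLinear).map eC.toLinearMap) = commSpan2 A brA ∧
    -- (iv) `H̄₀(A, V(A)) ≅ HC₁^M(A)`
    (∃ e : (VA.carrier ⧸ LinearMap.range ν₂.toLinear) ≃ₗ[K]
        (A.carrier ⊗[K] A.carrier ⧸ JA A),
      SuperEquiv (gradeQuot VA.grading (LinearMap.range ν₂.toLinear))
        (gradeQuot (gradeTensor A.grading A.grading) (JA A)) e ∧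
      ∀ w : A.carrier ⊗[K] A.carrier,
        e ((LinearMap.range ν₂.toLinear).mkQ (eV.symm ((IA A).mkQ w)))
          = (JA A).mkQ w) := by
  have hν₁0 : ν₁.toLinear = 0 := by
    refine LinearMap.ext_on h₁.span_eq_top ?_
    rintro _ ⟨α, β, m, n, rfl⟩
    simp [hν₁, htrivLH]
  have hmem := bracket_mem_commSpan hbrA
  refine ⟨by rw [hν₁0, LinearMap.range_zero], ?_, ?_, ?_⟩
  · have hker : LinearMap.ker ν₁.toLinear = ⊤ := by rw [hν₁0, LinearMap.ker_zero]
    have hpker : LinearMap.ker ((commSpan A).mkQ ∘ₗ eA.toLinearMap) ≤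
        Submodule.span K {z | ∃ (α β : ZMod 2) (x : LA.grading α)
          (y : LA.grading β), z = LA.bracket x.1 y.1} := by
      rw [LinearMap.ker_comp, Submodule.ker_mkQ, Submodule.comap_equiv_eq_map_symm, commSpan,
        Submodule.map_span_le]
      rintro _ ⟨α, β, a, b, rfl⟩
      obtain ⟨x, hx, hxa⟩ := (hLAgr α).ge a.2
      obtain ⟨y, hy, hyb⟩ := (hLAgr β).ge b.2
      refine Submodule.subset_span ⟨α, β, ⟨x, hx⟩, ⟨y, hy⟩, ?_⟩
      rw [LinearEquiv.coe_coe] at hxa hyb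
      rw [LinearEquiv.coe_coe, LinearEquiv.symm_apply_eq, hLAbr, hxa, hyb, hbrA]
    obtain ⟨E, hE, hEpair⟩ := h₁.exists_superEquiv_of_trivial htrivLH htrivHL hHab
      (isInternal_gradeQuot_commSpan A) ((commSpan A).mkQ ∘ₗ eA.toLinearMap)
      ((Submodule.mkQ_surjective _).comp eA.surjective)
      (fun α => by rw [Submodule.map_comp, hLAgr]; rfl)
      (fun x y => by
        rw [LinearMap.comp_apply, LinearEquiv.coe_coe, hLAbr, Submodule.mkQ_apply,
          Submodule.Quotient.mk_eq_zero]
        exact hmem _ _)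
      hpker eH hHgr
    refine ⟨(LinearEquiv.ofTop _ hker).trans E, fun α => ?_, hEpair⟩
    rw [← hE α]
    ext x
    constructor
    · rintro ⟨t, ht, rfl⟩
      exact ⟨t, ht, rfl⟩
    · rintro ⟨t, ht, rfl⟩
      exact ⟨⟨t, hker ▸ Submodule.mem_top⟩, ht, rfl⟩
  · rw [h₃.range_eq_span_act ν₃.toLinear hν₃, Submodule.map_span, Submodule.map_span, commSpan2]
    congr 1
    ext x
    constructor
    · rintro ⟨_, ⟨_, ⟨a, y, rfl⟩, rfl⟩, rfl⟩
      exact ⟨eA a, (eC y).1, (eC y).2, haLC a y⟩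
    · rintro ⟨a, y, hy, rfl⟩
      refine ⟨_, ⟨_, ⟨eA.symm a, eC.symm ⟨y, hy⟩, rfl⟩, rfl⟩, ?_⟩
      refine (haLC _ _).trans ?_
      rw [eA.apply_symm_apply, eC.apply_symm_apply]
  · have hR : (LinearMap.range ν₂.toLinear).map eV.toLinearMap = (JA A).map (IA A).mkQ := by
      rw [map_mkQ_JA hbrA hc, h₂.range_eq_span_act ν₂.toLinear hν₂, Submodule.map_span]
      congr 1
      ext x
      constructor
      · rintro ⟨_, ⟨a, v, rfl⟩, rfl⟩
        obtain ⟨w, hw⟩ := Submodule.mkQ_surjective _ (eV v)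
        refine ⟨eA a, w, ?_⟩
        rw [← eV.symm_apply_apply v, ← hw, ha1, LinearEquiv.coe_coe, eV.apply_symm_apply]
      · rintro ⟨a, w, rfl⟩
        refine ⟨_, ⟨eA.symm a, eV.symm ((IA A).mkQ w), rfl⟩, ?_⟩
        rw [ha1, LinearEquiv.coe_coe, eV.apply_symm_apply, eA.apply_symm_apply]
    let e := (Submodule.Quotient.equiv _ _ eV hR).trans
      (Submodule.quotientQuotientEquivQuotient (IA A) (JA A) (IA_le_JA A))
    have he : ∀ w : A.carrier ⊗[K] A.carrier,
        e ((LinearMap.range ν₂.toLinear).mkQ (eV.symm ((IA A).mkQ w))) = (JA A).mkQ w := by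
      intro w
      simp only [e, LinearEquiv.trans_apply, Submodule.mkQ_apply, Submodule.Quotient.equiv_apply,
        Submodule.mapQ_apply, LinearEquiv.coe_coe, eV.apply_symm_apply]
      rfl
    refine ⟨e, fun γ => ?_, he⟩
    have hgr : VA.grading γ = (gradeTensor A.grading A.grading γ).map
        (eV.symm.toLinearMap ∘ₗ (IA A).mkQ) := by
      rw [Submodule.map_comp]
      change _ = (gradeQuot (gradeTensor A.grading A.grading) (IA A) γ).map _
      rw [← hVgr, ← Submodule.map_comp]
      simp
    rw [gradeQuot, gradeQuot, hgr, ← Submodule.map_comp, ← Submodule.map_comp]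
    congr 1
    exact LinearMap.ext he

end SuperNA
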